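/- arXiv:2106.15886 — 2 statements merged into one kernel-verified Lean document; each statement's English description precedes it below -/
import Mathlib

section
/- Let s : ℤ → Σ be a balanced sequence. Then the map u ↦ μ_q(u)₁₂ is injective on the language L(s). -/
open Polynomial

/-- The letter `a` is encoded by `false`, the letter `b` by `true`.
`μ_q` of a single letter. -/
noncomputable def muqLetter : Bool → Matrix (Fin 2) (Fin 2) (Polynomial ℤ)
  | false => !![X + X ^ 2, 1; X, 1]
  | true  => !![X + 2 * X ^ 2 + X ^ 3 + X ^ 4, 1 + X; X + X ^ 2, 1]

/-- The monoid homomorphism `μ_q : Σ* → M₂(ℤ[q])`, extended multiplicatively,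
with the empty word mapped to the identity matrix. -/
noncomputable def muq (w : List Bool) : Matrix (Fin 2) (Fin 2) (Polynomial ℤ) :=
  (w.map muqLetter).prod

/-- `u` is a factor of the biinfinite sequence `s`. -/
def IsFactor (s : ℤ → Bool) (u : List Bool) : Prop :=
  ∃ k : ℤ, u = (List.range u.length).map fun i => s (k + i)

/-- `s` is balanced: any two factors of the same length have numbers of
occurrences of each letter differing by at most 1. -/
def IsBalanced (s : ℤ → Bool) : Prop :=
  ∀ u v : List Bool, IsFactor s u → IsFactor s v → u.length = v.length →
    ∀ c : Bool, |(u.count c : ℤ) - (v.count c : ℤ)| ≤ 1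

/-! ### Evaluation of `μ_q` at a primitive sixth root of unity -/

theorem muq_append (u v : List Bool) : muq (u ++ v) = muq u * muq v := by
  simp [muq]

theorem muq_cons (c : Bool) (w : List Bool) : muq (c :: w) = muqLetter c * muq w := by
  simp [muq]

theorem length_eq_count_false_add_count_true (w : List Bool) :
    w.length = w.count false + w.count true := by
  induction w with
  | nil => rfl
  | cons c w ih => cases c <;> simp <;> omega

/-- At a root `z` of `q² - q + 1` the matrices `μ_q(a)` and `μ_q(b)` are commuting multiples of
unipotent matrices, so `μ_q(w)` depends only on the numbers of letters in `w`. -/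
theorem aeval_muq {z : ℂ} (hz : z ^ 2 = z - 1) (w : List Bool) :
    let h : ℂ := w.count false + (2 - z) * w.count true
    let e : ℂ := z ^ (w.count false + 2 * w.count true)
    aeval z (muq w 0 0) = e * (1 + h * z) ∧ aeval z (muq w 0 1) = e * (h * (1 - z)) ∧
      aeval z (muq w 1 0) = e * h ∧ aeval z (muq w 1 1) = e * (1 - h * z) := by
  induction w with
  | nil => simp [muq]
  | cons c w ih =>
    obtain ⟨h00, h01, h10, h11⟩ := ih
    have h3 : z ^ 3 = -1 := by linear_combination (z + 1) * hz
    have h4 : z ^ 4 = -z := by linear_combination z * h3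
    cases c
    all_goals
      simp only [muq_cons, muqLetter, Matrix.mul_apply, Fin.sum_univ_two, Matrix.of_apply,
        Matrix.cons_val', Matrix.cons_val_zero, Matrix.cons_val_one, Matrix.cons_val_fin_one,
        map_add, map_mul, map_pow, map_one, aeval_X, map_ofNat, h00, h01, h10, h11, h4, h3,
        List.count_cons, beq_self_eq_true, if_true, beq_iff_eq, if_false,
        Bool.false_eq_true, Bool.true_eq_false, add_zero, Nat.cast_add, Nat.cast_one,
        pow_add, pow_mul, pow_one, mul_add, mul_one]
      generalize z ^ w.count false = x
      generalize (z ^ 2) ^ w.count true = y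
      generalize (w.count false : ℂ) = m
      generalize (w.count true : ℂ) = n
      refine ⟨?_, ?_, ?_, ?_⟩ <;> grind

theorem aeval_muq_zero_one {z : ℂ} (hz : z ^ 2 = z - 1) (w : List Bool) :
    aeval z (muq w 0 1) = z ^ (w.count false + 2 * w.count true) *
      ((w.count false + (2 - z) * w.count true) * (1 - z)) :=
  (aeval_muq hz w).2.1

theorem int_add_int_mul_eq {z : ℂ} (him : z.im ≠ 0) {a b c d : ℤ}
    (h : (a : ℂ) + b * z = c + d * z) : a = c ∧ b = d := by
  have h1 := congrArg Complex.im h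
  simp only [Complex.add_im, Complex.intCast_im, Complex.mul_im, Complex.intCast_re, zero_mul,
    add_zero, zero_add] at h1
  have hbd : b = d := by exact_mod_cast mul_right_cancel₀ him h1
  subst hbd
  exact ⟨by exact_mod_cast add_right_cancel h, rfl⟩

/-- Elements of `ℤ[z]` in the cone spanned by `1` and `2 - z` that differ by a power of the sixth
root of unity `z` are equal. -/
theorem cone_unique {z : ℂ} (hz : z ^ 2 = z - 1) (him : z.im ≠ 0) {a b c d : ℕ} (t : ℕ)
    (ht : t < 6) (h : z ^ t * (a + (2 - z) * b : ℂ) = c + (2 - z) * d) : a = c ∧ b = d := by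
  have h3 : z ^ 3 = -1 := by linear_combination (z + 1) * hz
  have key : ∀ x y : ℤ, z ^ t * (a + (2 - z) * b : ℂ) = x + y * z →
      x = c + 2 * d ∧ y = -d := by
    intro x y hxy
    apply int_add_int_mul_eq him
    rw [← hxy, h]
    push_cast
    ring
  interval_cases t
  · have := key (a + 2 * b) (-b) (by push_cast; ring)
    omega
  · have := key b (a + b) (by push_cast; linear_combination (-b : ℂ) * hz)
    omega
  · have := key (-a - b) (a + 2 * b) (by
      push_cast; linear_combination (a + 2 * b - b * z - b : ℂ) * hz)
    omega
  · have := key (-a - 2 * b) b (by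
      push_cast; linear_combination (a + 2 * b - b * z : ℂ) * h3)
    omega
  · have := key (-b) (-a - b) (by
      push_cast; linear_combination (a + 2 * b - b * z : ℂ) * z * h3 + (b : ℂ) * hz)
    omega
  · have := key (a + b) (-a - 2 * b) (by
      push_cast
      linear_combination (a + 2 * b - b * z : ℂ) * z ^ 2 * h3 - (a + 2 * b - b * z - b : ℂ) * hz)
    omega

/-- The polynomial `μ_q(w)₁₂` determines the numbers of letters in `w`. -/
theorem count_eq_of_muq_eq {z : ℂ} (hz : z ^ 2 = z - 1) (him : z.im ≠ 0) {u v : List Bool}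
    (h : muq u 0 1 = muq v 0 1) :
    u.count false = v.count false ∧ u.count true = v.count true := by
  have h3 : z ^ 3 = -1 := by linear_combination (z + 1) * hz
  have h6 : z ^ 6 = 1 := by linear_combination (z ^ 3 - 1) * h3
  have hz0 : z ≠ 0 := by rintro rfl; simp at him
  have hz1 : 1 - z ≠ 0 := by
    intro h1
    apply him
    rw [← sub_eq_zero.1 h1, Complex.one_im]
  have hev := congrArg (aeval z) h
  simp only [aeval_muq_zero_one hz] at hev
  set e := u.count false + 2 * u.count true
  set f := v.count false + 2 * v.count true
  rw [← mul_assoc, ← mul_assoc] at hev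
  have hev' := mul_right_cancel₀ hz1 hev
  refine cone_unique hz him ((e + 5 * f) % 6) (Nat.mod_lt _ (by norm_num)) ?_
  have hmod : z ^ ((e + 5 * f) % 6) = z ^ (e + 5 * f) := by
    conv_rhs => rw [← Nat.mod_add_div (e + 5 * f) 6, pow_add, pow_mul, h6, one_pow, mul_one]
  have hf : z ^ f * z ^ (5 * f) = 1 := by
    rw [← pow_add, show f + 5 * f = 6 * f by ring, pow_mul, h6, one_pow]
  rw [hmod, pow_add]
  linear_combination z ^ (5 * f) * hev' +
    (v.count false + (2 - z) * v.count true : ℂ) * hf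

/-! ### The first-order term at the root of unity -/

theorem muq_swap (p s : List Bool) :
    muq (p ++ true :: false :: s) 0 1 - muq (p ++ false :: true :: s) 0 1 =
      X * (1 + X) * (X ^ 2 - X + 1) * (muq p 0 0 * muq s 1 1 - X * (muq p 0 1 * muq s 0 1)) := by
  simp only [muq_append, muq_cons, muqLetter, Matrix.mul_apply, Fin.sum_univ_two, Matrix.of_apply,
    Matrix.cons_val', Matrix.cons_val_zero, Matrix.cons_val_one, Matrix.cons_val_fin_one]
  ring

/-- A weighted area under the lattice path of `w`, with parameters `N` and `n` standing for the
length of `w` and its number of occurrences of `b`. -/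
noncomputable def pathWeight (z : ℂ) (N n : ℕ) (w : List Bool) : ℂ :=
  ∑ i ∈ Finset.range (N + 1), (((w.take i).count true : ℂ) * ((w.take i).count true + 1 - n) +
    z * (((w.take i).count true : ℂ) * (2 * i - N)))

theorem pathWeight_swap (z : ℂ) (N n : ℕ) (p s : List Bool) (hN : p.length < N) :
    pathWeight z N n (p ++ true :: false :: s) - pathWeight z N n (p ++ false :: true :: s) =
      2 * (p.count true + 1) - n + z * (2 * (p.length + 1) - N) := by
  rw [pathWeight, pathWeight, ← Finset.sum_sub_distrib,
    Finset.sum_eq_single (p.length + 1)]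
  · simp only [List.take_length_add_append, List.take_succ_cons, List.take_zero, List.count_append,
      List.count_cons, List.count_nil, beq_self_eq_true, if_true, beq_iff_eq, if_false,
      Bool.false_eq_true, add_zero, zero_add]
    push_cast
    ring
  · intro i _ hi
    have : ((p ++ true :: false :: s).take i).count true =
        ((p ++ false :: true :: s).take i).count true := by
      rcases Nat.lt_or_ge p.length i with h | h
      · obtain ⟨m, rfl⟩ : ∃ m, i = p.length + (m + 1 + 1) := ⟨i - p.length - 2, by omega⟩
        simp only [List.take_length_add_append, List.take_succ_cons, List.count_append,
          List.count_cons]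
        simp
      · rw [List.take_append_of_le_length h, List.take_append_of_le_length h]
    rw [this, sub_self]
  · intro h
    exact absurd (Finset.mem_range.2 (by omega)) h

theorem aeval_swap_cofactor {z : ℂ} (hz : z ^ 2 = z - 1) (p s : List Bool) (N n : ℕ)
    (hN : p.length + 2 + s.length = N) (hn : p.count true + 1 + s.count true = n) :
    z ^ (3 : ℕ) * aeval z (muq p 0 0 * muq s 1 1 - X * (muq p 0 1 * muq s 0 1)) =
      z ^ (N + n) * (2 * (p.count true + 1) - n + z * (2 * (p.length + 1) - N)) := by
  subst hN hn
  obtain ⟨p00, p01, -, -⟩ := aeval_muq hz p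
  obtain ⟨-, s01, -, s11⟩ := aeval_muq hz s
  have he : p.length + 2 + s.length + (p.count true + 1 + s.count true) =
      3 + (p.count false + 2 * p.count true) + (s.count false + 2 * s.count true) := by
    have := length_eq_count_false_add_count_true p
    have := length_eq_count_false_add_count_true s
    omega
  rw [he, pow_add, pow_add]
  simp only [map_sub, map_mul, aeval_X, p00, p01, s01, s11,
    length_eq_count_false_add_count_true p, length_eq_count_false_add_count_true s]
  push_cast
  generalize z ^ (p.count false + 2 * p.count true) = x
  generalize z ^ (s.count false + 2 * s.count true) = y
  generalize (p.count false : ℂ) = a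
  generalize (p.count true : ℂ) = b
  generalize (s.count false : ℂ) = c
  generalize (s.count true : ℂ) = d
  have key : (1 + (a + (2 - z) * b) * z) * (1 - (c + (2 - z) * d) * z) -
      z * ((a + (2 - z) * b) * (1 - z) * ((c + (2 - z) * d) * (1 - z))) =
      2 * (b + 1) - (b + 1 + d) + z * (2 * (a + b + 1) - (a + b + 2 + (c + d))) := by
    grind
  linear_combination z ^ 3 * x * y * key

theorem muq_sub_of_perm {z : ℂ} (hz : z ^ 2 = z - 1) (N n : ℕ) {u v : List Bool}
    (h : u.Perm v) : ∀ p : List Bool, (p ++ u).length = N → (p ++ u).count true = n →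
    ∃ W : ℤ[X], muq (p ++ v) 0 1 - muq (p ++ u) 0 1 = X * (1 + X) * (X ^ 2 - X + 1) * W ∧
      z ^ (3 : ℕ) * aeval z W =
        z ^ (N + n) * (pathWeight z N n (p ++ v) - pathWeight z N n (p ++ u)) := by
  induction h with
  | nil => exact fun p _ _ => ⟨0, by simp, by simp⟩
  | cons x _ ih =>
    intro p hN hn
    simpa using ih (p ++ [x]) (by simpa using hN) (by simpa using hn)
  | swap x y l =>
    intro p hN hn
    cases x <;> cases y
    · exact ⟨0, by simp, by simp⟩
    · obtain ⟨W, hW⟩ : ∃ W, W = muq p 0 0 * muq l 1 1 - X * (muq p 0 1 * muq l 0 1) := ⟨_, rfl⟩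
      simp at hN hn
      refine ⟨-W, ?_, ?_⟩
      · rw [hW, mul_neg, ← muq_swap, neg_sub]
      · rw [← neg_sub, pathWeight_swap z N n p l (by omega), map_neg, mul_neg, hW,
          aeval_swap_cofactor hz p l N n (by omega) (by omega), mul_neg]
    · simp at hN hn
      refine ⟨_, muq_swap p l, ?_⟩
      rw [pathWeight_swap z N n p l (by omega),
          aeval_swap_cofactor hz p l N n (by omega) (by omega)]
    · exact ⟨0, by simp, by simp⟩
  | trans h₁ _ ih₁ ih₂ =>
    intro p hN hn
    obtain ⟨W₁, h1, h1'⟩ := ih₁ p hN hn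
    obtain ⟨W₂, h2, h2'⟩ := ih₂ p (by simpa [h₁.length_eq] using hN)
      (by simpa [h₁.count_eq] using hn)
    refine ⟨W₁ + W₂, by linear_combination h1 + h2, ?_⟩
    rw [map_add]
    linear_combination h1' + h2'

theorem pathWeight_eq_of_muq_eq {z : ℂ} (hz : z ^ 2 = z - 1) (hz0 : z ≠ 0) {u v : List Bool}
    (hp : u.Perm v) (h : muq u 0 1 = muq v 0 1) :
    pathWeight z u.length (u.count true) v = pathWeight z u.length (u.count true) u := by
  obtain ⟨W, hW, hW'⟩ := muq_sub_of_perm hz _ _ hp [] rfl rfl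
  simp only [List.nil_append, h, sub_self] at hW hW'
  have hne : (X * (1 + X) * (X ^ 2 - X + 1) : ℤ[X]) ≠ 0 := by
    intro h0
    have := congrArg (eval 1) h0
    norm_num at this
  have hW0 : W = 0 := by
    rcases mul_eq_zero.1 hW.symm with h0 | h0
    · exact absurd h0 hne
    · exact h0
  rw [hW0, map_zero, mul_zero] at hW'
  rcases mul_eq_zero.1 hW'.symm with h0 | h0
  · exact absurd h0 (pow_ne_zero _ hz0)
  · exact sub_eq_zero.1 h0

/-! ### Counting letters in balanced sequences -/

theorem isFactor_iff {s : ℤ → Bool} {u : List Bool} :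
    IsFactor s u ↔ ∃ k : ℤ, u = (List.range u.length).map fun i : ℕ => s (k + i) := by
  simp [IsFactor, ← List.map_eq_flatMap, Function.comp_def]

/-- The number of occurrences of `b` in the factor of `s` of length `n` at position `k`. -/
def countB (s : ℤ → Bool) (k : ℤ) (n : ℕ) : ℤ :=
  ((List.range n).map fun i : ℕ => s (k + i)).count true

theorem countB_add (s : ℤ → Bool) (k : ℤ) (m n : ℕ) :
    countB s k (m + n) = countB s k m + countB s (k + m) n := by
  simp only [countB, List.range_add, List.map_append, List.map_map, List.count_append,
    Nat.cast_add, Function.comp_def, add_assoc]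

theorem abs_countB_sub_le {s : ℤ → Bool} (hs : IsBalanced s) (k l : ℤ) (n : ℕ) :
    |countB s k n - countB s l n| ≤ 1 :=
  hs _ _ (isFactor_iff.2 ⟨k, by simp⟩) (isFactor_iff.2 ⟨l, by simp⟩) (by simp) true

theorem countB_mul_le {s : ℤ → Bool} {n : ℕ} {c : ℤ} (h : ∀ k, countB s k n ≤ c) (k : ℤ) (t : ℕ) :
    countB s k (t * n) ≤ t * c := by
  induction t with
  | zero => simp [countB]
  | succ t ih =>
    rw [add_mul, one_mul, countB_add]
    have := h (k + (t * n : ℕ))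
    push_cast at *
    linarith

theorem le_countB_mul {s : ℤ → Bool} {n : ℕ} {c : ℤ} (h : ∀ k, c ≤ countB s k n) (k : ℤ) (t : ℕ) :
    t * c ≤ countB s k (t * n) := by
  induction t with
  | zero => simp [countB]
  | succ t ih =>
    rw [add_mul, one_mul, countB_add]
    have := h (k + (t * n : ℕ))
    push_cast at *
    linarith

/-- If two factors of a balanced sequence have the same length and the same number of `b`s, then
wherever the path of one is above that of the other, it is above the diagonal. -/
theorem lt_mul_countB {s : ℤ → Bool} (hs : IsBalanced s) {k l : ℤ} {i N : ℕ}
    (hi : 0 < i) (hiN : i < N) (hl : countB s l i = countB s k i + 1) :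
    i * countB s k N < N * countB s l i := by
  by_contra! hcon
  obtain ⟨j, rfl⟩ : ∃ j, N = i + (j + 1) := ⟨N - i - 1, by omega⟩
  obtain ⟨t, rfl⟩ : ∃ t, i = t + 1 := ⟨i - 1, by omega⟩
  rw [countB_add s k] at hcon
  set U := countB s k (t + 1) with hU
  set C := countB s (k + (t + 1 : ℕ)) (j + 1) with hC
  have hup : ∀ m, countB s m (t + 1) ≤ U + 1 := fun m => by
    have := abs_le.1 (abs_countB_sub_le hs m k (t + 1))
    omega
  have hlo : ∀ m, C - 1 ≤ countB s m (j + 1) := fun m => by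
    have := abs_le.1 (abs_countB_sub_le hs m (k + (t + 1 : ℕ)) (j + 1))
    omega
  have h1 : countB s k ((t + 1) * (j + 1)) ≤ U + j * (U + 1) := by
    rw [show (t + 1) * (j + 1) = (t + 1) + j * (t + 1) by ring, countB_add]
    exact add_le_add le_rfl (countB_mul_le hup _ j)
  have h2 := le_countB_mul hlo k (t + 1)
  rw [hl] at hcon
  push_cast at *
  nlinarith

theorem countB_eq_of_weights_eq {s : ℤ → Bool} (hs : IsBalanced s) {k l : ℤ} {N : ℕ}
    (hN : countB s k N = countB s l N)
    (hsq : ∑ i ∈ Finset.range (N + 1), countB s k i * (countB s k i + 1 - countB s k N) =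
      ∑ i ∈ Finset.range (N + 1), countB s l i * (countB s l i + 1 - countB s k N))
    (hlin : ∑ i ∈ Finset.range (N + 1), countB s k i * (2 * i - N) =
      ∑ i ∈ Finset.range (N + 1), countB s l i * (2 * i - N))
    (hle : ∀ i ≤ N, countB s k i ≤ countB s l i) :
    ∀ i ≤ N, countB s k i = countB s l i := by
  have hpos : ∀ i ∈ Finset.range (N + 1),
      0 ≤ (N * (countB s l i * (countB s l i + 1 - countB s k N)) -
          countB s k N * (countB s l i * (2 * i - N))) -
        (N * (countB s k i * (countB s k i + 1 - countB s k N)) -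
          countB s k N * (countB s k i * (2 * i - N))) ∧
      (countB s k i ≠ countB s l i →
        0 < (N * (countB s l i * (countB s l i + 1 - countB s k N)) -
          countB s k N * (countB s l i * (2 * i - N))) -
        (N * (countB s k i * (countB s k i + 1 - countB s k N)) -
          countB s k N * (countB s k i * (2 * i - N)))) := by
    intro i hi
    have hiN : i ≤ N := Nat.lt_succ_iff.1 (Finset.mem_range.1 hi)
    by_cases heq : countB s k i = countB s l i
    · rw [heq]
      simp
    · suffices h : _ by exact ⟨le_of_lt h, fun _ => h⟩
      have h1 := abs_le.1 (abs_countB_sub_le hs k l i)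
      have h2 := hle i hiN
      have hl : countB s l i = countB s k i + 1 := by omega
      have hi0 : 0 < i := Nat.pos_of_ne_zero fun h0 => heq (by simp [h0, countB])
      have hiN' : i < N := lt_of_le_of_ne hiN fun h0 => heq (by rw [h0, hN])
      have := lt_mul_countB hs hi0 hiN' hl
      rw [hl] at this ⊢
      linarith
  have hsum : ∑ i ∈ Finset.range (N + 1),
      ((N * (countB s l i * (countB s l i + 1 - countB s k N)) -
          countB s k N * (countB s l i * (2 * i - N))) -
        (N * (countB s k i * (countB s k i + 1 - countB s k N)) -
          countB s k N * (countB s k i * (2 * i - N)))) = 0 := by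
    simp only [Finset.sum_sub_distrib, ← Finset.mul_sum, hsq, hlin, sub_self]
  have hzero := (Finset.sum_eq_zero_iff_of_nonneg fun i hi => (hpos i hi).1).1 hsum
  intro i hi
  by_contra hne
  have hmem : i ∈ Finset.range (N + 1) := Finset.mem_range.2 (by omega)
  exact absurd (hzero i hmem) ((hpos i hmem).2 hne).ne'

/-- The prefix counts of two factors of a balanced sequence are comparable. -/
theorem countB_le_or_ge {s : ℤ → Bool} (hs : IsBalanced s) (k l : ℤ) :
    (∀ i, countB s k i ≤ countB s l i) ∨ ∀ i, countB s l i ≤ countB s k i := by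
  by_contra! hcon
  obtain ⟨⟨i, hi⟩, j, hj⟩ := hcon
  rcases le_total i j with h | h <;> obtain ⟨m, rfl⟩ := Nat.exists_eq_add_of_le h
  · have := abs_le.1 (abs_countB_sub_le hs (k + i) (l + i) m)
    rw [countB_add, countB_add] at hj
    omega
  · have := abs_le.1 (abs_countB_sub_le hs (k + j) (l + j) m)
    rw [countB_add, countB_add] at hi
    omega

theorem factor_eq_of_countB_eq {s : ℤ → Bool} {k l : ℤ} {N : ℕ}
    (h : ∀ i ≤ N, countB s k i = countB s l i) :
    ((List.range N).map fun i : ℕ => s (k + i)) = (List.range N).map fun i : ℕ => s (l + i) := by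
  refine List.map_congr_left fun i hi => ?_
  have hi := List.mem_range.1 hi
  have h1 := h (i + 1) hi
  rw [countB_add, countB_add, h i hi.le] at h1
  have h2 := add_left_cancel h1
  simp only [countB, List.range_one, List.map_cons, List.map_nil, Nat.cast_zero, add_zero] at h2
  cases hk : s (k + i) <;> cases hl : s (l + i) <;> simp_all

theorem pathWeight_factor (z : ℂ) (s : ℤ → Bool) (k : ℤ) (N n : ℕ) :
    pathWeight z N n ((List.range N).map fun i : ℕ => s (k + i)) =
      ((∑ i ∈ Finset.range (N + 1), countB s k i * (countB s k i + 1 - n) : ℤ) : ℂ) +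
        ((∑ i ∈ Finset.range (N + 1), countB s k i * (2 * i - N) : ℤ) : ℂ) * z := by
  push_cast
  rw [pathWeight, Finset.sum_mul, ← Finset.sum_add_distrib]
  refine Finset.sum_congr rfl fun i hi => ?_
  have hi : i ≤ N := Nat.lt_succ_iff.1 (Finset.mem_range.1 hi)
  rw [← List.map_take, List.take_range, min_eq_left hi, countB, Int.cast_natCast]
  ring

theorem exists_sq_eq_sub_one_im_ne_zero : ∃ z : ℂ, z ^ 2 = z - 1 ∧ z.im ≠ 0 := by
  refine ⟨⟨1 / 2, √3 / 2⟩, ?_, by simp⟩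
  have h : √3 * √3 = 3 := Real.mul_self_sqrt (by norm_num)
  apply Complex.ext
  · simp [pow_two]
    nlinarith
  · simp [pow_two]
    ring

theorem muq12_injective_on_balanced_language
    (s : ℤ → Bool) (hs : IsBalanced s) :
    Set.InjOn (fun u => muq u 0 1) {u : List Bool | IsFactor s u} := by
  obtain ⟨z, hz, him⟩ := exists_sq_eq_sub_one_im_ne_zero
  have hz0 : z ≠ 0 := by rintro rfl; simp at him
  intro u hu v hv h
  obtain ⟨k, hu⟩ := isFactor_iff.1 hu
  obtain ⟨l, hv⟩ := isFactor_iff.1 hv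
  replace h : muq u 0 1 = muq v 0 1 := h
  obtain ⟨hf, ht⟩ := count_eq_of_muq_eq hz him h
  have hp : u.Perm v := List.perm_iff_count.2 fun c => by cases c <;> assumption
  have hw := pathWeight_eq_of_muq_eq hz hz0 hp h
  rw [← hp.length_eq] at hv
  have hk : countB s k u.length = u.count true := by rw [countB, ← hu]
  have hl : countB s l u.length = u.count true := by rw [countB, ← hv, ht]
  generalize u.count true = n at *
  generalize u.length = N at *
  subst hu hv
  rw [pathWeight_factor, pathWeight_factor] at hw
  obtain ⟨hsq, hlin⟩ := int_add_int_mul_eq him hw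
  rcases countB_le_or_ge hs k l with hle | hle
  · refine factor_eq_of_countB_eq (countB_eq_of_weights_eq hs (hk.trans hl.symm) ?_ hlin.symm
      fun i _ => hle i)
    rw [hk]
    exact hsq.symm
  · refine (factor_eq_of_countB_eq (countB_eq_of_weights_eq hs (hl.trans hk.symm) ?_ hlin
      fun i _ => hle i)).symm
    rw [hl]
    exact hsq
end

section
/- Let s : ℤ → Σ be a balanced sequence and let γ > 0 be a real number. Then the map w ↦ μ_q(w)₁₂ evaluated at q = γ is strictly increasing on L(s) with respect to the radix order <_radix; in particular it is injective on L(s). -/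
open Polynomial

/-- Radix order on binary words (with `a = false < b = true`). -/
def RadixLt (u v : List Bool) : Prop :=
  u.length < v.length ∨ (u.length = v.length ∧ List.Lex (· < ·) u v)

/-- The specialization of `muqLetter` at a real number `q`. -/
def realLetter (q : ℝ) : Bool → Matrix (Fin 2) (Fin 2) ℝ
  | false => !![q + q ^ 2, 1; q, 1]
  | true => !![q + 2 * q ^ 2 + q ^ 3 + q ^ 4, 1 + q; q + q ^ 2, 1]

/-- The specialization of `muq` at a real number `q`. -/
def realMu (q : ℝ) (w : List Bool) : Matrix (Fin 2) (Fin 2) ℝ :=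
  (w.map (realLetter q)).prod

/-- Up to a scalar, the difference between the images of `ba` and `ab`. -/
def swapMatrix (q : ℝ) : Matrix (Fin 2) (Fin 2) ℝ := !![0, 1; -q, 0]

lemma map_muqLetter (q : ℝ) (c : Bool) :
    (eval₂RingHom (Int.castRingHom ℝ) q).mapMatrix (muqLetter c) = realLetter q c := by
  cases c <;> ext i j <;> fin_cases i <;> fin_cases j <;> simp [muqLetter, realLetter]

lemma eval₂_muq (q : ℝ) (w : List Bool) (i j : Fin 2) :
    eval₂ (Int.castRingHom ℝ) q (muq w i j) = realMu q w i j := by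
  have h : (eval₂RingHom (Int.castRingHom ℝ) q).mapMatrix (muq w) = realMu q w := by
    rw [muq, realMu, map_list_prod, List.map_map]
    congr 2
    funext c
    exact map_muqLetter q c
  rw [← h]
  rfl

lemma realMu_nil (q : ℝ) : realMu q [] = 1 := by simp [realMu]

lemma realMu_cons (q : ℝ) (c : Bool) (w : List Bool) :
    realMu q (c :: w) = realLetter q c * realMu q w := by simp [realMu]

lemma realMu_append (q : ℝ) (u v : List Bool) :
    realMu q (u ++ v) = realMu q u * realMu q v := by simp [realMu]

lemma realMu_nonneg {q : ℝ} (hq : 0 < q) (w : List Bool) :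
    0 < realMu q w 0 0 ∧ 0 ≤ realMu q w 0 1 ∧ 0 ≤ realMu q w 1 0 ∧ 0 < realMu q w 1 1 := by
  induction w with
  | nil => simp [realMu_nil]
  | cons c w ih =>
    obtain ⟨h1, h2, h3, h4⟩ := ih
    rw [realMu_cons]
    cases c <;> simp only [realLetter, Matrix.mul_apply, Fin.sum_univ_two, Matrix.of_apply,
      Matrix.cons_val_zero, Matrix.cons_val_one, Matrix.cons_val', Matrix.cons_val_fin_one] <;>
      refine ⟨?_, ?_, ?_, ?_⟩ <;> positivity

lemma realMu_zero_one_lt_append_singleton {q : ℝ} (hq : 0 < q) (w : List Bool) (c : Bool) :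
    realMu q w 0 1 < realMu q (w ++ [c]) 0 1 := by
  obtain ⟨h1, -, -, -⟩ := realMu_nonneg hq w
  rw [realMu_append, realMu_cons, realMu_nil]
  cases c <;> simp [realLetter, Matrix.mul_apply, Fin.sum_univ_two] <;> positivity

lemma realMu_zero_one_le_append {q : ℝ} (hq : 0 < q) (u v : List Bool) :
    realMu q u 0 1 ≤ realMu q (u ++ v) 0 1 := by
  induction v using List.reverseRecOn with
  | nil => simp
  | append_singleton v c ih =>
    rw [← List.append_assoc]
    exact ih.trans (realMu_zero_one_lt_append_singleton hq _ c).le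

lemma realMu_zero_one_lt_replace_last {q : ℝ} (hq : 0 < q) (p : List Bool) :
    realMu q (p ++ [false]) 0 1 < realMu q (p ++ [true]) 0 1 := by
  obtain ⟨h1, -, -, -⟩ := realMu_nonneg hq p
  simp [realMu_append, realMu_cons, realMu_nil, realLetter, Matrix.mul_apply, Fin.sum_univ_two]
  nlinarith [mul_pos h1 hq]

lemma realLetter_mul_swapMatrix_mul_realLetter (q : ℝ) (c : Bool) :
    realLetter q c * swapMatrix q * realLetter q c =
      (if c then q ^ 4 else q ^ 2) • swapMatrix q := by
  cases c <;> ext i j <;> fin_cases i <;> fin_cases j <;>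
    simp [realLetter, swapMatrix] <;> ring

lemma realLetter_true_mul_swapMatrix_mul_realLetter_false (q : ℝ) :
    realLetter q true * swapMatrix q * realLetter q false =
      !![q ^ 5, q ^ 2 + q ^ 3 + q ^ 4; 0, q ^ 2] := by
  ext i j; fin_cases i <;> fin_cases j <;>
    simp [realLetter, swapMatrix, Matrix.mul_apply, Fin.sum_univ_two] <;> ring

lemma realLetter_commutator (q : ℝ) :
    realLetter q true * realLetter q false - realLetter q false * realLetter q true =
      (q + q ^ 4) • swapMatrix q := by
  ext i j; fin_cases i <;> fin_cases j <;>
    simp [realLetter, swapMatrix] <;> ring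

lemma realMu_reverse_mul_swapMatrix_pos {q : ℝ} (hq : 0 < q) (x y : List Bool)
    (h : ∀ z, z ++ [false] <+: x → ¬ z ++ [true] <+: y) :
    0 < (realMu q x.reverse * swapMatrix q * realMu q y) 0 1 := by
  induction x generalizing y with
  | nil =>
    simpa [realMu_nil, swapMatrix, Matrix.mul_apply, Fin.sum_univ_two]
      using (realMu_nonneg hq y).2.2.2
  | cons c x ih =>
    cases y with
    | nil =>
      simpa [realMu_nil, swapMatrix, Matrix.mul_apply, Fin.sum_univ_two]
        using (realMu_nonneg hq (x.reverse ++ [c])).1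
    | cons d y =>
      have key : realMu q (c :: x).reverse * swapMatrix q * realMu q (d :: y) =
          realMu q x.reverse * (realLetter q c * swapMatrix q * realLetter q d) * realMu q y := by
        simp only [List.reverse_cons, realMu_append, realMu_cons, realMu_nil, mul_one, mul_assoc]
      rw [key]
      by_cases hcd : c = d
      · subst hcd
        rw [realLetter_mul_swapMatrix_mul_realLetter, mul_smul_comm, smul_mul_assoc]
        have := ih y fun z hz hz' => h (c :: z) (by simpa using hz) (by simpa using hz')
        rw [Matrix.smul_apply, smul_eq_mul]
        have hc : 0 < (if c then q ^ 4 else q ^ 2) := by split <;> positivity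
        exact mul_pos hc this
      · cases c
        · have hd : d = true := by simpa using Ne.symm hcd
          subst hd
          exact absurd (by simp) (h [] (by simp))
        · have hd : d = false := by simpa using Ne.symm hcd
          subst hd
          rw [realLetter_true_mul_swapMatrix_mul_realLetter_false]
          obtain ⟨h1, h2, h3, h4⟩ := realMu_nonneg hq x.reverse
          obtain ⟨k1, k2, k3, k4⟩ := realMu_nonneg hq y
          simp only [Matrix.mul_apply, Fin.sum_univ_two, Matrix.of_apply, Matrix.cons_val_zero,
            Matrix.cons_val_one, Matrix.cons_val', Matrix.cons_val_fin_one]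
          positivity

lemma realMu_zero_one_lt_swap {q : ℝ} (hq : 0 < q) (p t : List Bool)
    (h : ∀ z, z ++ [false] <+: p.reverse → ¬ z ++ [true] <+: t) :
    realMu q (p ++ false :: true :: t) 0 1 < realMu q (p ++ true :: false :: t) 0 1 := by
  have hpos := realMu_reverse_mul_swapMatrix_pos hq p.reverse t h
  rw [List.reverse_reverse] at hpos
  have key : realMu q (p ++ true :: false :: t) - realMu q (p ++ false :: true :: t) =
      (q + q ^ 4) • (realMu q p * swapMatrix q * realMu q t) := by
    rw [← smul_mul_assoc, ← mul_smul_comm, ← realLetter_commutator]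
    simp only [realMu_append, realMu_cons, mul_sub, sub_mul, mul_assoc]
  have key' := congrFun (congrFun key 0) 1
  rw [Matrix.sub_apply, Matrix.smul_apply, smul_eq_mul] at key'
  have : 0 < (q + q ^ 4) * (realMu q p * swapMatrix q * realMu q t) 0 1 :=
    mul_pos (by positivity) hpos
  linarith

lemma realMu_first_row_bound {q : ℝ} (hq : 0 < q) (w : List Bool) :
    (q + q ^ 2 + q ^ 3) * realMu q w 0 1 < (1 + q) * realMu q w 0 0 := by
  induction w using List.reverseRecOn with
  | nil => simp [realMu_nil]; positivity
  | append_singleton w c ih =>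
    obtain ⟨h1, h2, -, -⟩ := realMu_nonneg hq w
    rw [realMu_append, realMu_cons, realMu_nil]
    cases c <;> simp [realLetter, Matrix.mul_apply, Fin.sum_univ_two]
    · have h3 : 0 < q ^ 2 * ((1 + q) * realMu q w 0 0 - (q + q ^ 2 + q ^ 3) * realMu q w 0 1) +
          q ^ 5 * realMu q w 0 1 :=
        add_pos_of_pos_of_nonneg (mul_pos (by positivity) (sub_pos.2 ih)) (by positivity)
      have h4 : 0 < (1 + q) * (q ^ 2 * realMu q w 0 0 - q ^ 3 * realMu q w 0 1) := by
        linear_combination h3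
      have h5 := (mul_pos_iff_of_pos_left (by positivity)).1 h4
      linear_combination h5
    · have h3 : 0 < realMu q w 0 0 * (1 + q) * (q ^ 2 + q ^ 4) + realMu q w 0 1 * q ^ 2 := by
        positivity
      linear_combination h3

lemma realMu_second_row_bound {q : ℝ} (hq : 0 < q) (w : List Bool) (c : Bool) :
    q * realMu q (w ++ [c]) 1 1 ≤ realMu q (w ++ [c]) 1 0 := by
  obtain ⟨-, -, h3, h4⟩ := realMu_nonneg hq w
  rw [realMu_append, realMu_cons, realMu_nil]
  cases c <;> simp [realLetter, Matrix.mul_apply, Fin.sum_univ_two]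
  · nlinarith [mul_nonneg h3 (pow_pos hq 2).le]
  · nlinarith [mul_nonneg h3 (pow_pos hq 2).le, mul_nonneg h3 (pow_pos hq 3).le,
      mul_nonneg h3 (pow_pos hq 4).le, mul_pos h4 (pow_pos hq 2)]

lemma realMu_zero_one_true_cons_lt {q : ℝ} (hq : 0 < q) (w : List Bool) (c : Bool) :
    realMu q (true :: w) 0 1 < realMu q (false :: w ++ [c]) 0 1 := by
  obtain ⟨h1, h2, h3, h4⟩ := realMu_nonneg hq w
  have hlast : realMu q (false :: w ++ [false]) 0 1 ≤ realMu q (false :: w ++ [c]) 0 1 := by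
    cases c
    · exact le_rfl
    · exact (realMu_zero_one_lt_replace_last hq _).le
  refine lt_of_lt_of_le ?_ hlast
  have key : 0 < q * ((1 + q) * realMu q w 0 0 - (q + q ^ 2 + q ^ 3) * realMu q w 0 1) +
      (realMu q w 1 0 - q * realMu q w 1 1) := by
    induction w using List.reverseRecOn with
    | nil => simp [realMu_nil]; nlinarith [mul_pos hq hq]
    | append_singleton w d _ =>
      have hr1 := mul_pos hq (sub_pos.2 (realMu_first_row_bound hq (w ++ [d])))
      have hr2 := realMu_second_row_bound hq w d
      linarith
  simp [realMu_append, realMu_cons, realMu_nil, realLetter, Matrix.mul_apply, Fin.sum_univ_two]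
  nlinarith [key]

/-- The discrepancy between `α * i` and the number of letters `b` in the prefix of length `i`. -/
noncomputable def discrepancy (α : ℝ) (w : List Bool) (i : ℕ) : ℝ :=
  i * α - ((w.take i).count true : ℕ)

/-- All factors `x` of `w` contain strictly between `α * |x| - 1` and `α * |x| + 1` letters `b`. -/
def SlopeBalanced (α : ℝ) (w : List Bool) : Prop :=
  ∀ i ≤ w.length, ∀ j ≤ w.length, discrepancy α w i - discrepancy α w j < 1

lemma count_take_swap (p t : List Bool) (i : ℕ) :
    ((p ++ true :: false :: t).take i).count true =
      ((p ++ false :: true :: t).take i).count true + if i = p.length + 1 then 1 else 0 := by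
  simp only [List.take_append, List.count_append]
  rcases Nat.lt_or_ge p.length i with h | h
  · obtain ⟨m, rfl⟩ := Nat.exists_eq_add_of_lt h
    rw [show p.length + m + 1 - p.length = m + 1 by omega]
    cases m with
    | zero => simp
    | succ m => simp
  · simp [Nat.sub_eq_zero_of_le h]; omega

lemma count_take_replace_last (p : List Bool) (i : ℕ) (hi : i ≤ p.length + 1) :
    ((p ++ [true]).take i).count true =
      ((p ++ [false]).take i).count true + if i = p.length + 1 then 1 else 0 := by
  simp only [List.take_append, List.count_append]
  rcases Nat.lt_or_ge p.length i with h | h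
  · obtain rfl : i = p.length + 1 := by omega
    simp
  · simp [Nat.sub_eq_zero_of_le h]; omega

lemma count_take_succ (p t : List Bool) (c : Bool) :
    ((p ++ c :: t).take (p.length + 1)).count true = p.count true + c.toNat := by
  rw [List.take_length_add_append]
  cases c <;> simp

lemma eq_of_count_take_eq {u v : List Bool} (hlen : u.length = v.length)
    (h : ∀ i ≤ u.length, (u.take i).count true = (v.take i).count true) : u = v := by
  induction u generalizing v with
  | nil => exact (List.length_eq_zero_iff.1 hlen.symm).symm
  | cons c u ih =>
    cases v with
    | nil => simp at hlen
    | cons d v =>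
      have hcd : c = d := by
        have := h 1 (by simp)
        cases c <;> cases d <;> simp_all
      subst hcd
      congr 1
      refine ih (by simpa using hlen) fun i hi => ?_
      have := h (i + 1) (by simpa using hi)
      simpa [List.count_cons] using this

lemma SlopeBalanced.abs_factor_lt {α : ℝ} {x y z : List Bool}
    (h : SlopeBalanced α (x ++ y ++ z)) : |y.length * α - (y.count true : ℕ)| < 1 := by
  have hx : discrepancy α (x ++ y ++ z) x.length = x.length * α - (x.count true : ℕ) := by
    rw [discrepancy, List.append_assoc, List.take_left]
  have hxy : discrepancy α (x ++ y ++ z) (x ++ y).length =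
      (x ++ y).length * α - ((x ++ y).count true : ℕ) := by
    rw [discrepancy, List.take_left]
  have h1 := h x.length (by simp) (x ++ y).length (by simp)
  have h2 := h (x ++ y).length (by simp) x.length (by simp)
  rw [hx, hxy] at h1 h2
  simp only [List.length_append, List.count_append, Nat.cast_add] at h1 h2
  rw [abs_lt]
  constructor <;> linarith

lemma SlopeBalanced.no_bad_factorization {α : ℝ} {p t : List Bool}
    (h : SlopeBalanced α (p ++ false :: true :: t)) (z : List Bool)
    (hp : z ++ [false] <+: p.reverse) : ¬ z ++ [true] <+: t := by
  rintro ⟨t', rfl⟩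
  obtain ⟨p', hp'⟩ := hp
  have hp : p = p'.reverse ++ (false :: z.reverse) := by
    rw [← List.reverse_reverse p, ← hp']; simp
  subst hp
  have h1 : SlopeBalanced α (p'.reverse ++ (false :: z.reverse ++ [false]) ++
      (true :: z ++ true :: t')) := by simpa using h
  have h2 : SlopeBalanced α (p'.reverse ++ (false :: z.reverse ++ [false]) ++
      (true :: z ++ [true]) ++ t') := by simpa using h
  have h1 := (abs_lt.1 h1.abs_factor_lt).2
  have h2 := (abs_lt.1 h2.abs_factor_lt).1
  simp at h1 h2
  linarith

/-- Raising by one the count of letters `b` in a prefix whose discrepancy is strictly maximal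
keeps a word balanced. -/
lemma SlopeBalanced.of_count_take {α : ℝ} {u w : List Bool} (hu : SlopeBalanced α u) (k : ℕ)
    (hlen : w.length = u.length) (hk : k ≤ u.length)
    (hmax : ∀ i ≤ u.length, i ≠ k → discrepancy α u i < discrepancy α u k)
    (hw : ∀ i ≤ u.length,
      (w.take i).count true = (u.take i).count true + if i = k then 1 else 0) :
    SlopeBalanced α w := by
  have hd : ∀ i ≤ u.length,
      discrepancy α w i = discrepancy α u i - if i = k then 1 else 0 := by
    intro i hi
    rw [discrepancy, hw i hi, discrepancy]
    split_ifs <;> push_cast <;> ring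
  intro i hi j hj
  rw [hlen] at hi hj
  rw [hd i hi, hd j hj]
  have := hu i hi j hj
  by_cases hjk : j = k
  · subst hjk
    by_cases hij : i = j
    · simp [hij]
    · have := hmax i hi hij
      simp only [hij, if_true, if_false]
      linarith
  · simp only [hjk, if_false]
    split_ifs <;> linarith

lemma discrepancy_ne {α : ℝ} (hα : Irrational α) (w : List Bool) {i j : ℕ} (hij : i ≠ j) :
    discrepancy α w i ≠ discrepancy α w j := by
  intro h
  have hirr : Irrational (((i : ℤ) - j : ℤ) * α) :=
    hα.intCast_mul (sub_ne_zero.2 (by exact_mod_cast hij))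
  refine hirr ⟨(((w.take i).count true : ℕ) : ℚ) - ((w.take j).count true : ℕ), ?_⟩
  rw [discrepancy, discrepancy] at h
  push_cast
  linarith

/-- One step up in the chain of balanced words: if the discrepancy of `u` is strictly maximal
at a positive `k`, the word obtained from `u` by raising the `k`-th prefix count exists. -/
lemma exists_raise {α q : ℝ} (hα1 : α < 1) (hq : 0 < q) {u : List Bool} (hu : SlopeBalanced α u)
    {k : ℕ} (hk0 : 0 < k) (hk : k ≤ u.length)
    (hmax : ∀ i ≤ u.length, i ≠ k → discrepancy α u i < discrepancy α u k) :
    ∃ w : List Bool, w.length = u.length ∧ realMu q u 0 1 < realMu q w 0 1 ∧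
      ∀ i ≤ u.length,
        (w.take i).count true = (u.take i).count true + if i = k then 1 else 0 := by
  obtain ⟨m, rfl⟩ : ∃ m, k = m + 1 := ⟨k - 1, by omega⟩
  obtain ⟨p, c, t, rfl, rfl⟩ : ∃ p c t, u = p ++ c :: t ∧ p.length = m :=
    ⟨u.take m, u[m], u.drop (m + 1), by simp, by simp; omega⟩
  have hprev := hmax p.length (by simp) (by omega)
  have hc : c = false := by
    by_contra hc
    rw [Bool.not_eq_false] at hc
    subst hc
    simp only [discrepancy, count_take_succ, List.take_left] at hprev
    push_cast at hprev
    simp at hprev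
    linarith
  subst hc
  cases t with
  | nil =>
    refine ⟨p ++ [true], by simp, realMu_zero_one_lt_replace_last hq p, fun i hi => ?_⟩
    exact count_take_replace_last p i (by simpa using hi)
  | cons d t =>
    have hnext := hmax (p.length + 2) (by simp) (by omega)
    have hd : d = true := by
      by_contra hd
      rw [Bool.not_eq_true] at hd
      subst hd
      have e : ((p ++ false :: false :: t).take (p.length + 2)).count true = p.count true := by
        rw [List.take_length_add_append]
        simp
      simp only [discrepancy, count_take_succ, e, List.take_left] at hprev hnext
      push_cast at hprev hnext
      simp at hprev hnext
      linarith
    subst hd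
    exact ⟨p ++ true :: false :: t, by simp,
      realMu_zero_one_lt_swap hq p t hu.no_bad_factorization,
      fun i _ => count_take_swap p t i⟩

lemma eq_or_realMu_zero_one_lt {α q : ℝ} (hα : Irrational α) (hα1 : α < 1) (hq : 0 < q)
    (u v : List Bool) (hlen : u.length = v.length) (hu : SlopeBalanced α u)
    (hv : SlopeBalanced α v)
    (h1 : ∀ i ≤ u.length, (u.take i).count true ≤ (v.take i).count true)
    (h2 : ∀ i ≤ u.length, (v.take i).count true ≤ (u.take i).count true + 1) :
    u = v ∨ realMu q u 0 1 < realMu q v 0 1 := by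
  induction hN : ∑ i ∈ Finset.range (u.length + 1),
      ((v.take i).count true - (u.take i).count true) using Nat.strong_induction_on
      generalizing u with
  | _ N ih =>
  by_cases heq : ∀ i ≤ u.length, (u.take i).count true = (v.take i).count true
  · exact Or.inl (eq_of_count_take_eq hlen heq)
  right
  push Not at heq
  obtain ⟨i, hi, hne⟩ := heq
  obtain ⟨k, hk, hkmax⟩ := Finset.exists_max_image (Finset.range (u.length + 1))
    (discrepancy α u) ⟨0, by simp⟩
  have hk : k ≤ u.length := by simpa [Nat.lt_succ_iff] using hk
  have hkmax : ∀ j ≤ u.length, discrepancy α u j ≤ discrepancy α u k :=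
    fun j hj => hkmax j (by simpa [Nat.lt_succ_iff] using hj)
  have hDk : (v.take k).count true = (u.take k).count true + 1 := by
    by_contra hcon
    have hk' : (v.take k).count true = (u.take k).count true := by
      have := h1 k hk; have := h2 k hk; omega
    have hi' : (v.take i).count true = (u.take i).count true + 1 := by
      have := h1 i hi; have := h2 i hi; omega
    have hvi := hv k (hlen ▸ hk) i (hlen ▸ hi)
    have hui := hkmax i hi
    simp only [discrepancy, hk', hi'] at hvi hui
    push_cast at hvi
    linarith
  have hk0 : 0 < k := by
    rcases Nat.eq_zero_or_pos k with rfl | h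
    · simp at hDk
    · exact h
  have hstrict : ∀ j ≤ u.length, j ≠ k → discrepancy α u j < discrepancy α u k :=
    fun j hj hjk => lt_of_le_of_ne (hkmax j hj) (discrepancy_ne hα u hjk)
  obtain ⟨w, hwlen, hlt, hw⟩ := exists_raise hα1 hq hu hk0 hk hstrict
  have hwb := hu.of_count_take k hwlen hk hstrict hw
  have hsum : ∑ i ∈ Finset.range (w.length + 1),
      ((v.take i).count true - (w.take i).count true) < N := by
    rw [← hN, hwlen]
    refine Finset.sum_lt_sum (fun j hj => ?_) ⟨k, by simpa [Nat.lt_succ_iff] using hk, ?_⟩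
    · have := hw j (by simpa [Nat.lt_succ_iff] using hj)
      omega
    · have := hw k hk
      simp only [if_true] at this
      omega
  have hwv1 : ∀ j ≤ w.length, (w.take j).count true ≤ (v.take j).count true := by
    intro j hj
    rw [hwlen] at hj
    have := h1 j hj
    rw [hw j hj]
    split_ifs with hjk
    · rw [hjk]; omega
    · exact this
  have hwv2 : ∀ j ≤ w.length, (v.take j).count true ≤ (w.take j).count true + 1 := by
    intro j hj
    rw [hwlen] at hj
    have := h2 j hj
    rw [hw j hj]
    omega
  rcases ih _ hsum w (hwlen.trans hlen) hwb hwv1 hwv2 rfl with rfl | h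
  · exact hlt
  · exact hlt.trans h

/-- The factor of length `n` of `s` starting at position `k`. -/
def window (s : ℤ → Bool) (k : ℤ) (n : ℕ) : List Bool :=
  (List.range n).map fun i : ℕ => s (k + i)

lemma length_window (s : ℤ → Bool) (k : ℤ) (n : ℕ) : (window s k n).length = n := by
  simp [window]

lemma isFactor_iff_exists_eq_window {s : ℤ → Bool} {u : List Bool} :
    IsFactor s u ↔ ∃ k, u = window s k u.length := by
  simp [IsFactor, window, ← List.map_eq_flatMap, Function.comp_def]

lemma isFactor_window (s : ℤ → Bool) (k : ℤ) (n : ℕ) : IsFactor s (window s k n) :=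
  isFactor_iff_exists_eq_window.2 ⟨k, by rw [length_window]⟩

lemma window_add (s : ℤ → Bool) (k : ℤ) (m n : ℕ) :
    window s k (m + n) = window s k m ++ window s (k + m) n := by
  simp [window, List.range_add, Function.comp_def, add_assoc]

lemma IsFactor.take {s : ℤ → Bool} {u : List Bool} (h : IsFactor s u) {n : ℕ}
    (hn : n ≤ u.length) : IsFactor s (u.take n) := by
  obtain ⟨k, hk⟩ := isFactor_iff_exists_eq_window.1 h
  obtain ⟨m, hm⟩ := Nat.exists_eq_add_of_le hn
  rw [hm, window_add] at hk
  rw [hk, List.take_left' (length_window s k n)]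
  exact isFactor_window s k n

/-- The number of letters `b` in the factor of length `n` of `s` starting at position `k`. -/
def windowCount (s : ℤ → Bool) (k : ℤ) (n : ℕ) : ℕ := (window s k n).count true

lemma windowCount_add (s : ℤ → Bool) (k : ℤ) (m n : ℕ) :
    windowCount s k (m + n) = windowCount s k m + windowCount s (k + m) n := by
  simp [windowCount, window_add]

lemma windowCount_le (s : ℤ → Bool) (k : ℤ) (n : ℕ) : windowCount s k n ≤ n :=
  List.count_le_length.trans (length_window s k n).le

lemma IsBalanced.windowCount_le_add_one {s : ℤ → Bool} (hs : IsBalanced s) (k l : ℤ) (n : ℕ) :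
    windowCount s k n ≤ windowCount s l n + 1 := by
  have := hs (window s k n) (window s l n) (isFactor_window s k n) (isFactor_window s l n)
    (by simp [length_window]) true
  rw [abs_le] at this
  simp only [windowCount]
  omega

lemma le_windowCount_mul {s : ℤ → Bool} {n c : ℕ} (h : ∀ j, c ≤ windowCount s j n) (k : ℤ)
    (m : ℕ) : m * c ≤ windowCount s k (m * n) := by
  induction m generalizing k with
  | zero => simp
  | succ m ih =>
    rw [Nat.succ_mul, Nat.succ_mul, windowCount_add]
    exact add_le_add (ih k) (h _)

lemma windowCount_mul_le {s : ℤ → Bool} {n c : ℕ} (h : ∀ j, windowCount s j n ≤ c) (k : ℤ)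
    (m : ℕ) : windowCount s k (m * n) ≤ m * c := by
  induction m generalizing k with
  | zero => simp [windowCount, window]
  | succ m ih =>
    rw [Nat.succ_mul, Nat.succ_mul, windowCount_add]
    exact add_le_add (ih k) (h _)

lemma IsBalanced.mul_windowCount_lt {s : ℤ → Bool} (hs : IsBalanced s) (k l : ℤ) {m n : ℕ}
    (hm : 0 < m) : m * windowCount s k n < n * (windowCount s l m + 1) + m := by
  obtain ⟨m, rfl⟩ : ∃ m', m = m' + 1 := ⟨m - 1, by omega⟩
  have h1 := le_windowCount_mul (s := s) (c := windowCount s k n - 1) (n := n)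
    (fun j => by have := hs.windowCount_le_add_one k j n; omega) (k + n) m
  have h2 := windowCount_mul_le (s := s) (c := windowCount s l (m + 1) + 1) (n := m + 1)
    (fun j => hs.windowCount_le_add_one j l _) k n
  rw [show n * (m + 1) = n + m * n by ring, windowCount_add] at h2
  have h3 : m * windowCount s k n ≤ m * (windowCount s k n - 1) + m := by
    rw [← Nat.mul_succ]
    exact Nat.mul_le_mul_left _ (by omega)
  nlinarith

lemma IsBalanced.exists_slope {s : ℤ → Bool} (hs : IsBalanced s) (N : ℕ) :
    ∃ α : ℝ, Irrational α ∧ 0 < α ∧ α < 1 ∧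
      ∀ k n, 0 < n → n ≤ N → |(n : ℝ) * α - windowCount s k n| < 1 := by
  have hfin : ∀ c : ℝ, {x : ℝ | ∃ k n, 0 < n ∧ n ≤ N ∧ x = (windowCount s k n + c) / n}.Finite := by
    intro c
    refine (((Set.finite_Iic N).prod (Set.finite_Iic N)).image
      fun p : ℕ × ℕ => ((p.1 : ℝ) + c) / p.2).subset ?_
    rintro x ⟨k, n, -, hn, rfl⟩
    exact ⟨(windowCount s k n, n), ⟨(windowCount_le s k n).trans hn, hn⟩, rfl⟩
  obtain ⟨a, ha, hamax⟩ := Set.exists_max_image _ id ((hfin (-1)).insert 0) ⟨0, by simp⟩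
  obtain ⟨b, hb, hbmin⟩ := Set.exists_min_image _ id ((hfin 1).insert 1) ⟨1, by simp⟩
  have hab : a < b := by
    rcases ha with rfl | ⟨k, n, hn, -, rfl⟩ <;> rcases hb with rfl | ⟨l, m, hm, -, rfl⟩
    · exact one_pos
    · positivity
    · have : (windowCount s k n : ℝ) ≤ n := by exact_mod_cast windowCount_le s k n
      rw [div_lt_one (by positivity)]
      linarith
    · rw [div_lt_div_iff₀ (by positivity) (by positivity)]
      have : (m : ℝ) * windowCount s k n < n * (windowCount s l m + 1) + m := by
        exact_mod_cast hs.mul_windowCount_lt k l hm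
      linarith
  obtain ⟨α, hα, haα, hαb⟩ := exists_irrational_btwn hab
  refine ⟨α, hα, (hamax 0 (by simp)).trans_lt haα, hαb.trans_le (hbmin 1 (by simp)),
    fun k n hn hnN => ?_⟩
  have h1 := (hamax _ (Or.inr ⟨k, n, hn, hnN, rfl⟩)).trans_lt haα
  have h2 := hαb.trans_le (hbmin _ (Or.inr ⟨k, n, hn, hnN, rfl⟩))
  simp only [id] at h1 h2
  have hn' : (0 : ℝ) < n := by exact_mod_cast hn
  rw [div_lt_iff₀ hn'] at h1
  rw [lt_div_iff₀ hn'] at h2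
  rw [abs_lt]
  constructor <;> linarith

lemma IsFactor.slopeBalanced {s : ℤ → Bool} {α : ℝ} {N : ℕ}
    (hα : ∀ k n, 0 < n → n ≤ N → |(n : ℝ) * α - windowCount s k n| < 1) {u : List Bool}
    (hu : IsFactor s u) (hN : u.length ≤ N) : SlopeBalanced α u := by
  obtain ⟨k, hk⟩ := isFactor_iff_exists_eq_window.1 hu
  have hdisc : ∀ i m, i + m ≤ u.length →
      discrepancy α u (i + m) - discrepancy α u i = m * α - windowCount s (k + i) m := by
    intro i m him
    have htake : ∀ r ≤ u.length, (u.take r).count true = windowCount s k r := by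
      intro r hr
      obtain ⟨t, ht⟩ := Nat.exists_eq_add_of_le hr
      rw [ht, window_add] at hk
      rw [hk, List.take_left' (length_window s k r), windowCount]
    rw [discrepancy, discrepancy, htake _ him, htake _ (by omega), windowCount_add]
    push_cast
    ring
  intro i hi j hj
  rcases lt_trichotomy i j with h | rfl | h
  · obtain ⟨m, rfl⟩ := Nat.exists_eq_add_of_lt h
    have h1 := hdisc i (m + 1) hj
    have h2 := abs_lt.1 (hα (k + i) (m + 1) (by omega) (by omega))
    rw [← h1] at h2
    rw [add_assoc]
    linarith
  · simp
  · obtain ⟨m, rfl⟩ := Nat.exists_eq_add_of_lt h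
    have h1 := hdisc j (m + 1) hi
    have h2 := abs_lt.1 (hα (k + j) (m + 1) (by omega) (by omega))
    rw [← h1] at h2
    rw [add_assoc]
    linarith

/-- The prefix of length `n` of the characteristic Sturmian word of slope `α`. -/
noncomputable def charWord (α : ℝ) (n : ℕ) : List Bool :=
  (List.range n).map fun i => decide (⌊((i + 1 : ℕ) : ℝ) * α⌋₊ < ⌊((i + 2 : ℕ) : ℝ) * α⌋₊)

lemma length_charWord (α : ℝ) (n : ℕ) : (charWord α n).length = n := by simp [charWord]

lemma charWord_succ (α : ℝ) (n : ℕ) : ∃ c, charWord α (n + 1) = charWord α n ++ [c] :=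
  ⟨decide (⌊((n + 1 : ℕ) : ℝ) * α⌋₊ < ⌊((n + 2 : ℕ) : ℝ) * α⌋₊),
    by simp [charWord, List.range_succ]⟩

lemma count_take_charWord {α : ℝ} (h0 : 0 < α) (h1 : α < 1) {n i : ℕ} (hi : i ≤ n) :
    ((charWord α n).take i).count true = ⌊((i + 1 : ℕ) : ℝ) * α⌋₊ := by
  induction i with
  | zero => simp [Nat.floor_eq_zero.2 h1]
  | succ i ih =>
    have hlen : i < (charWord α n).length := by rw [length_charWord]; omega
    rw [List.take_succ_eq_append_getElem hlen, List.count_append, ih (by omega)]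
    have hle : ⌊((i + 1 : ℕ) : ℝ) * α⌋₊ ≤ ⌊((i + 2 : ℕ) : ℝ) * α⌋₊ :=
      Nat.floor_mono (by push_cast; nlinarith)
    have hle' : ⌊((i + 2 : ℕ) : ℝ) * α⌋₊ ≤ ⌊((i + 1 : ℕ) : ℝ) * α⌋₊ + 1 := by
      rw [← Nat.floor_add_one (by positivity)]
      exact Nat.floor_mono (by push_cast; nlinarith)
    by_cases hlt : ⌊((i + 1 : ℕ) : ℝ) * α⌋₊ < ⌊((i + 2 : ℕ) : ℝ) * α⌋₊
    · have : (charWord α n)[i] = true := by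
        simp only [charWord, List.getElem_map, List.getElem_range]
        exact decide_eq_true hlt
      rw [this, List.count_singleton_self]
      exact (hle'.antisymm hlt).symm
    · have : (charWord α n)[i] = false := by
        simp only [charWord, List.getElem_map, List.getElem_range]
        exact decide_eq_false hlt
      rw [this]
      exact hle.antisymm (not_lt.1 hlt)

lemma count_take_false_charWord {α : ℝ} (h0 : 0 < α) (h1 : α < 1) {n i : ℕ} (hi : i ≤ n + 1) :
    ((false :: charWord α n).take i).count true = ⌊(i : ℝ) * α⌋₊ := by
  cases i with
  | zero => simp
  | succ i =>
    rw [List.take_succ_cons, List.count_cons_of_ne (by simp),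
      count_take_charWord h0 h1 (by omega)]

lemma count_take_true_charWord {α : ℝ} (h0 : 0 < α) (h1 : α < 1) {n i : ℕ} (hi0 : 0 < i)
    (hi : i ≤ n + 1) :
    ((true :: charWord α n).take i).count true = ⌊(i : ℝ) * α⌋₊ + 1 := by
  obtain ⟨i, rfl⟩ : ∃ j, i = j + 1 := ⟨i - 1, by omega⟩
  rw [List.take_succ_cons, List.count_cons_self, count_take_charWord h0 h1 (by omega)]

lemma SlopeBalanced.false_charWord {α : ℝ} (h0 : 0 < α) (h1 : α < 1) (n : ℕ) :
    SlopeBalanced α (false :: charWord α n) := by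
  intro i hi j hj
  simp only [List.length_cons, length_charWord] at hi hj
  rw [discrepancy, discrepancy, count_take_false_charWord h0 h1 hi,
    count_take_false_charWord h0 h1 hj]
  have hi' := Nat.lt_floor_add_one ((i : ℝ) * α)
  have hj' := Nat.floor_le (show 0 ≤ (j : ℝ) * α by positivity)
  linarith

lemma SlopeBalanced.true_charWord {α : ℝ} (hα : Irrational α) (h0 : 0 < α) (h1 : α < 1) (n : ℕ) :
    SlopeBalanced α (true :: charWord α n) := by
  have hpos : ∀ i, 0 < i → i ≤ n + 1 → -1 < discrepancy α (true :: charWord α n) i ∧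
      discrepancy α (true :: charWord α n) i < 0 := by
    intro i hi0 hi
    rw [discrepancy, count_take_true_charWord h0 h1 hi0 hi]
    have h2 := Nat.lt_floor_add_one ((i : ℝ) * α)
    have h3 := Nat.floor_le (show 0 ≤ (i : ℝ) * α by positivity)
    have h4 : ((⌊(i : ℝ) * α⌋₊ : ℕ) : ℝ) ≠ i * α := fun h =>
      (hα.natCast_mul hi0.ne').ne_nat _ h.symm
    have h5 := lt_of_le_of_ne h3 h4
    push_cast
    constructor <;> linarith
  have hzero : discrepancy α (true :: charWord α n) 0 = 0 := by simp [discrepancy]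
  intro i hi j hj
  simp only [List.length_cons, length_charWord] at hi hj
  rcases Nat.eq_zero_or_pos i with rfl | hi0 <;> rcases Nat.eq_zero_or_pos j with rfl | hj0
  · simp
  · have := hpos j hj0 hj
    linarith
  · have := hpos i hi0 hi
    linarith
  · have := hpos i hi0 hi
    have := hpos j hj0 hj
    linarith

lemma SlopeBalanced.count_take_bounds {α : ℝ} (h0 : 0 < α) {w : List Bool}
    (hw : SlopeBalanced α w) {i : ℕ} (hi : i ≤ w.length) :
    ⌊(i : ℝ) * α⌋₊ ≤ (w.take i).count true ∧ (w.take i).count true ≤ ⌊(i : ℝ) * α⌋₊ + 1 := by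
  have h1 := hw i hi 0 (by simp)
  have h2 := hw 0 (by simp) i hi
  simp only [discrepancy, List.take_zero, List.count_nil] at h1 h2
  have h3 := Nat.lt_floor_add_one ((i : ℝ) * α)
  have h4 := Nat.floor_le (show 0 ≤ (i : ℝ) * α by positivity)
  push_cast at h1 h2
  constructor
  · rw [← Nat.lt_add_one_iff, Nat.floor_lt (by positivity)]
    push_cast
    linarith
  · rw [← Nat.lt_add_one_iff, ← Nat.cast_lt (α := ℝ)]
    push_cast
    linarith

lemma realMu_zero_one_lt_of_length_succ {α q : ℝ} (hα : Irrational α) (h0 : 0 < α) (h1 : α < 1)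
    (hq : 0 < q) {u v : List Bool} (hlen : v.length = u.length + 1) (hu : SlopeBalanced α u)
    (hv : SlopeBalanced α v) : realMu q u 0 1 < realMu q v 0 1 := by
  have hv' : realMu q (false :: charWord α u.length) 0 1 ≤ realMu q v 0 1 := by
    have hl : (false :: charWord α u.length).length = v.length := by
      simp [length_charWord, hlen]
    refine (eq_or_realMu_zero_one_lt hα h1 hq _ v hl (.false_charWord h0 h1 _) hv
      (fun i hi => ?_) (fun i hi => ?_)).elim (fun h => (congrArg (realMu q · 0 1) h).le) le_of_lt
    all_goals
      rw [hl] at hi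
      rw [count_take_false_charWord h0 h1 (by omega)]
    · exact (hv.count_take_bounds h0 hi).1
    · exact (hv.count_take_bounds h0 hi).2
  refine lt_of_lt_of_le ?_ hv'
  rcases Nat.eq_zero_or_pos u.length with hn | hn
  · rw [List.length_eq_zero_iff.1 hn]
    simp [charWord, realMu_nil, realMu_cons, realLetter]
  obtain ⟨n, hn⟩ : ∃ n, u.length = n + 1 := ⟨u.length - 1, by omega⟩
  have hu' : realMu q u 0 1 ≤ realMu q (true :: charWord α n) 0 1 := by
    have hl : u.length = (true :: charWord α n).length := by
      simp [length_charWord, hn]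
    refine (eq_or_realMu_zero_one_lt hα h1 hq u _ hl hu (.true_charWord hα h0 h1 _)
      (fun i hi => ?_) (fun i hi => ?_)).elim (fun h => (congrArg (realMu q · 0 1) h).le) le_of_lt
    all_goals
      have hb := hu.count_take_bounds h0 hi
      rcases Nat.eq_zero_or_pos i with rfl | hi0
      · simp
      · rw [count_take_true_charWord h0 h1 hi0 (by omega)]
        omega
  refine hu'.trans_lt ?_
  obtain ⟨c, hc⟩ := charWord_succ α n
  rw [hn, hc]
  exact realMu_zero_one_true_cons_lt hq _ c

lemma exists_first_difference_of_lex {u v : List Bool} (hlen : u.length = v.length)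
    (h : List.Lex (· < ·) u v) :
    ∃ p x y, u = p ++ false :: x ∧ v = p ++ true :: y := by
  induction h with
  | nil => simp at hlen
  | @cons c u v _ ih =>
    obtain ⟨p, x, y, rfl, rfl⟩ := ih (by simpa using hlen)
    exact ⟨c :: p, x, y, rfl, rfl⟩
  | @rel c u d v hcd =>
    obtain ⟨rfl, rfl⟩ := Bool.lt_iff.1 hcd
    exact ⟨[], u, v, rfl, rfl⟩

lemma realMu_zero_one_lt_of_lex {α q : ℝ} (hα : Irrational α) (h1 : α < 1)
    (hq : 0 < q) {u v : List Bool} (hlen : u.length = v.length) (hu : SlopeBalanced α u)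
    (hv : SlopeBalanced α v) (hlex : List.Lex (· < ·) u v) :
    realMu q u 0 1 < realMu q v 0 1 := by
  obtain ⟨p, x, y, hux, hvy⟩ := exists_first_difference_of_lex hlen hlex
  have hne : u ≠ v := by rintro rfl; simp [hux] at hvy
  have hpu : p.length + 1 ≤ u.length := by simp [hux]
  have hup : (u.take (p.length + 1)).count true = p.count true := by
    rw [hux, count_take_succ]; rfl
  have hvp : (v.take (p.length + 1)).count true = p.count true + 1 := by
    rw [hvy, count_take_succ]; rfl
  have key : ∀ i ≤ u.length, ∀ j ≤ u.length,
      ((u.take i).count true + (v.take j).count true : ℤ) <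
        (u.take j).count true + (v.take i).count true + 2 := by
    intro i hi j hj
    have h2 := hu j hj i hi
    have h3 := hv i (hlen ▸ hi) j (hlen ▸ hj)
    simp only [discrepancy] at h2 h3
    rw [← Int.cast_lt (R := ℝ)]
    push_cast
    linarith
  refine (eq_or_realMu_zero_one_lt hα h1 hq u v hlen hu hv (fun i hi => ?_)
    (fun i hi => ?_)).resolve_left hne
  · rcases Nat.lt_or_ge p.length i with hpi | hpi
    · have := key i hi (p.length + 1) hpu
      omega
    · rw [hux, hvy, List.take_append_of_le_length hpi, List.take_append_of_le_length hpi]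
  · have := key 0 (by simp) i hi
    simp at this
    omega

lemma IsBalanced.realMu_zero_one_lt {s : ℤ → Bool} (hs : IsBalanced s) {q : ℝ} (hq : 0 < q)
    {u v : List Bool} (hu : IsFactor s u) (hv : IsFactor s v) (huv : RadixLt u v) :
    realMu q u 0 1 < realMu q v 0 1 := by
  obtain ⟨α, hα, h0, h1, hbal⟩ := hs.exists_slope v.length
  rcases huv with hlt | ⟨hlen, hlex⟩
  · have htake : realMu q (v.take (u.length + 1)) 0 1 ≤ realMu q v 0 1 := by
      conv_rhs => rw [← List.take_append_drop (u.length + 1) v]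
      exact realMu_zero_one_le_append hq _ _
    refine lt_of_lt_of_le ?_ htake
    exact realMu_zero_one_lt_of_length_succ hα h0 h1 hq (by simp; omega)
      (hu.slopeBalanced hbal hlt.le) ((hv.take hlt).slopeBalanced hbal (by simp))
  · exact realMu_zero_one_lt_of_lex hα h1 hq hlen (hu.slopeBalanced hbal hlen.le)
      (hv.slopeBalanced hbal le_rfl) hlex

lemma radixLt_or_radixLt_of_ne {u v : List Bool} (h : u ≠ v) : RadixLt u v ∨ RadixLt v u := by
  rcases lt_trichotomy u.length v.length with hl | hl | hl
  · exact Or.inl (Or.inl hl)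
  · rcases lt_or_gt_of_ne h with h | h
    · exact Or.inl (Or.inr ⟨hl, h⟩)
    · exact Or.inr (Or.inr ⟨hl.symm, h⟩)
  · exact Or.inr (Or.inl hl)

theorem muq12_eval_strict_mono_and_injective_on_balanced_language
    (s : ℤ → Bool) (hs : IsBalanced s) (γ : ℝ) (hγ : 0 < γ) :
    (∀ u v : List Bool, IsFactor s u → IsFactor s v → RadixLt u v →
        Polynomial.eval₂ (Int.castRingHom ℝ) γ (muq u 0 1)
          < Polynomial.eval₂ (Int.castRingHom ℝ) γ (muq v 0 1)) ∧
    Set.InjOn (fun w => Polynomial.eval₂ (Int.castRingHom ℝ) γ (muq w 0 1))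
      {u : List Bool | IsFactor s u} := by
  have hmono : ∀ u v : List Bool, IsFactor s u → IsFactor s v → RadixLt u v →
      eval₂ (Int.castRingHom ℝ) γ (muq u 0 1) < eval₂ (Int.castRingHom ℝ) γ (muq v 0 1) := by
    intro u v hu hv huv
    rw [eval₂_muq, eval₂_muq]
    exact hs.realMu_zero_one_lt hγ hu hv huv
  refine ⟨hmono, fun u hu v hv huv => ?_⟩
  by_contra hne
  rcases radixLt_or_radixLt_of_ne hne with h | h
  · exact (hmono u v hu hv h).ne huv
  · exact (hmono v u hv hu h).ne' huv
end
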